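/- arXiv:2307.08542 — 5 statements merged into one kernel-verified Lean document; each statement's English description precedes it below -/
import Mathlib

section
/- Let (Ω, 𝓕, P) be a probability space, non-degenerate in the sense that there exists a measurable A with 0 < P(A) < 1. Let V be a real vector space, C ⊆ V a nonempty convex set, and U : C → ℝ mixture continuous (for all x, y ∈ C, the map α ↦ U(αx + (1−α)y) is continuous on [0,1]). Consider the acts given by simple measurable functions X : Ω → C (finite range, with each preimage X⁻¹{c} measurable), and define the preference ≽ by expected utility: X ≽ Y iff Σ_{c ∈ range X} U(c)·P(X⁻¹{c}) ≥ Σ_{c ∈ range Y} U(c)·P(Y⁻¹{c}). Then the following are equivalent: (i) ≽ is convex: for all acts X, Y and α ∈ (0,1), X ∼ Y implies αX + (1−α)Y ≽ X (mixtures taken statewise); (ii) ≽ is antimonotonically convex: the implication in (i) is imposed only for antimonotonic acts X, Y; (iii) U is concave: U(αx + (1−α)y) ≥ αU(x) + (1−α)U(y) for all x, y ∈ C and α ∈ (0,1). -/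
open MeasureTheory

section EU

variable {Ω : Type*} [MeasurableSpace Ω] {V : Type*}

/-- A simple act: a function with finite range, measurable preimages of
singletons, and values in the outcome set `C`. -/
def IsSimpleAct (C : Set V) (X : Ω → V) : Prop :=
  (Set.range X).Finite ∧ (∀ c : V, MeasurableSet (X ⁻¹' {c})) ∧ ∀ ω, X ω ∈ C

/-- The expected utility `Σ_{c} U(c) · P(X⁻¹{c})` of a simple act `X`
(as a finite sum over the range of `X`). -/
noncomputable def expectedUtility (P : Measure Ω) (U : V → ℝ) (X : Ω → V) : ℝ :=
  ∑ᶠ c : V, U c * (P (X ⁻¹' {c})).toReal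

/-- Two acts are antimonotonic if there are no states `ω, ω'` with
`X ω ≻ X ω'` and `Y ω ≻ Y ω'`, where outcomes are compared by utility. -/
def AntimonotonicUActs (U : V → ℝ) (X Y : Ω → V) : Prop :=
  ¬ ∃ ω ω' : Ω, U (X ω) > U (X ω') ∧ U (Y ω) > U (Y ω')

end EU

/-- The expected utility of a simple function is the integral of its utility. -/
theorem expectedUtility_simpleFunc {Ω : Type*} [MeasurableSpace Ω] (P : Measure Ω)
    [IsFiniteMeasure P] {V : Type*} (U : V → ℝ) (X : SimpleFunc Ω V) :
    expectedUtility P U X = ∫ ω, U (X ω) ∂P := by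
  have hpt : ∀ ω, U (X ω) = ∑ c ∈ X.range, (X ⁻¹' {c}).indicator (fun _ => U c) ω := by
    classical
    intro ω
    simp [Set.indicator_apply, Finset.sum_ite_eq]
  simp_rw [hpt]
  rw [integral_finsetSum _ fun c _ =>
      (integrable_const (U c)).indicator (X.measurableSet_fiber c),
    expectedUtility, finsum_eq_sum_of_support_subset (s := X.range)]
  · refine Finset.sum_congr rfl fun c _ => ?_
    rw [integral_indicator_const _ (X.measurableSet_fiber c), smul_eq_mul, mul_comm, Measure.real]
  · intro c hc
    by_contra hcr
    have : (X : Ω → V) ⁻¹' {c} = ∅ := by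
      rw [Set.preimage_singleton_eq_empty]
      simpa using hcr
    simp [this] at hc

theorem IsSimpleAct.exists_simpleFunc {Ω : Type*} [MeasurableSpace Ω] {V : Type*} {C : Set V}
    {X : Ω → V} (hX : IsSimpleAct C X) : ∃ S : SimpleFunc Ω V, ⇑S = X :=
  ⟨⟨X, hX.2.1, hX.1⟩, rfl⟩

theorem isSimpleAct_simpleFunc {Ω : Type*} [MeasurableSpace Ω] {V : Type*} {C : Set V}
    (S : SimpleFunc Ω V) (hS : ∀ ω, S ω ∈ C) : IsSimpleAct C S :=
  ⟨S.finite_range, S.measurableSet_fiber, hS⟩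

theorem expectedUtility_piecewise {Ω : Type*} [MeasurableSpace Ω] (P : Measure Ω)
    [IsProbabilityMeasure P] {V : Type*} (U : V → ℝ) {A : Set Ω} (hA : MeasurableSet A)
    (a b : V) :
    expectedUtility P U
        (SimpleFunc.piecewise A hA (SimpleFunc.const Ω a) (SimpleFunc.const Ω b)) =
      P.real A * U a + (1 - P.real A) * U b := by
  classical
  rw [expectedUtility_simpleFunc]
  have h : (fun ω => U ((SimpleFunc.piecewise A hA (SimpleFunc.const Ω a)
      (SimpleFunc.const Ω b)) ω)) = A.piecewise (fun _ => U a) (fun _ => U b) := by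
    ext ω
    by_cases hω : ω ∈ A <;> simp [hω]
  rw [h, integral_piecewise hA (integrable_const _).integrableOn (integrable_const _).integrableOn]
  simp [probReal_compl_eq_one_sub hA]

/-- Concave utility makes expected utility concave in the act. -/
theorem expectedUtility_mix_ge {Ω : Type*} [MeasurableSpace Ω] (P : Measure Ω)
    [IsFiniteMeasure P] {V : Type*} [AddCommGroup V] [Module ℝ V] {C : Set V} {U : V → ℝ}
    (hU : ∀ x ∈ C, ∀ y ∈ C, ∀ α ∈ Set.Ioo (0:ℝ) 1,
      U (α • x + (1 - α) • y) ≥ α * U x + (1 - α) * U y)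
    {X Y : Ω → V} (hX : IsSimpleAct C X) (hY : IsSimpleAct C Y) {α : ℝ}
    (hα : α ∈ Set.Ioo (0:ℝ) 1) :
    α * expectedUtility P U X + (1 - α) * expectedUtility P U Y ≤
      expectedUtility P U (α • X + (1 - α) • Y) := by
  obtain ⟨S, rfl⟩ := hX.exists_simpleFunc
  obtain ⟨T, rfl⟩ := hY.exists_simpleFunc
  have hmix : α • (S : Ω → V) + (1 - α) • (T : Ω → V) =
      ((S.pair T).map fun q : V × V => α • q.1 + (1 - α) • q.2 : SimpleFunc Ω V) := by
    ext ω; simp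
  have hint : ∀ R : SimpleFunc Ω V, Integrable (fun ω => U (R ω)) P := fun R =>
    SimpleFunc.integrable_of_isFiniteMeasure (R.map U)
  rw [hmix, expectedUtility_simpleFunc, expectedUtility_simpleFunc, expectedUtility_simpleFunc,
    ← integral_const_mul, ← integral_const_mul,
    ← integral_add ((hint S).const_mul _) ((hint T).const_mul _)]
  refine integral_mono (((hint S).const_mul _).add ((hint T).const_mul _)) (hint _) fun ω => ?_
  simpa using hU _ (hX.2.2 ω) _ (hY.2.2 ω) α hα

/-- Mixing a binary lottery, with weight `p` on its first outcome, with its certainty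
equivalent never makes it worse. -/
def MixesWithCertaintyEquivalent (p : ℝ) (s : Set ℝ) (f : ℝ → ℝ) : Prop :=
  ∀ z ∈ s, ∀ a ∈ s, ∀ b ∈ s, f z = p * f a + (1 - p) * f b → ∀ α ∈ Set.Ioo (0:ℝ) 1,
    f z ≤ p * f (α * z + (1 - α) * a) + (1 - p) * f (α * z + (1 - α) * b)

theorem MixesWithCertaintyEquivalent.mono {p : ℝ} {s t : Set ℝ} {f : ℝ → ℝ}
    (h : MixesWithCertaintyEquivalent p t f) (hst : s ⊆ t) :
    MixesWithCertaintyEquivalent p s f :=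
  fun z hz a ha b hb => h z (hst hz) a (hst ha) b (hst hb)

/-- If averaging `f` over opposite displacements never decreases it on `[u, v]`, and the
displacements drift to the left, then `f` does not increase from `u` to `v`. -/
theorem le_of_forall_le_displaced_average {p a b u v ε : ℝ} {f : ℝ → ℝ} (hf : Continuous f)
    (hε : 0 < ε) (huv : u ≤ v) (hab : (1 - p) * b < p * a)
    (h : ∀ z ∈ Set.Icc u v, ∀ t ∈ Set.Ioo 0 ε,
      f z ≤ p * f (z - t * a) + (1 - p) * f (z + t * b)) : f v ≤ f u := by
  by_contra! hlt
  let G : ℝ → ℝ := fun x => ∫ y in (0:ℝ)..x, f y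
  have hG : ∀ x, HasDerivAt G (f x) x := fun x => hf.integral_hasStrictDerivAt 0 x |>.hasDerivAt
  have hGsub : ∀ x y, ∫ z in x..y, f z = G y - G x := fun x y =>
    (intervalIntegral.integral_interval_sub_left (hf.intervalIntegrable _ _)
      (hf.intervalIntegrable _ _)).symm
  let K : ℝ → ℝ := fun t => p * (G (v - t * a) - G (u - t * a)) +
    (1 - p) * (G (v + t * b) - G (u + t * b))
  have hK : ∀ t ∈ Set.Ioo 0 ε, K 0 ≤ K t := by
    intro t ht
    have h0 : K 0 = ∫ z in u..v, f z := by simp only [K, hGsub]; simp; ring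
    have h1 : K t = ∫ z in u..v, (p * f (z - t * a) + (1 - p) * f (z + t * b)) := by
      rw [intervalIntegral.integral_add
        (Continuous.intervalIntegrable (by fun_prop) _ _)
        (Continuous.intervalIntegrable (by fun_prop) _ _),
        intervalIntegral.integral_const_mul, intervalIntegral.integral_const_mul,
        intervalIntegral.integral_comp_sub_right, intervalIntegral.integral_comp_add_right,
        hGsub, hGsub]
    rw [h0, h1]
    exact intervalIntegral.integral_mono_on huv (hf.intervalIntegrable _ _)
      (Continuous.intervalIntegrable (by fun_prop) _ _) fun z hz => h z hz t ht
  have hl : ∀ w c : ℝ, HasDerivAt (fun t => G (w + t * c)) (f w * c) 0 := by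
    intro w c
    have h1 : HasDerivAt (fun t : ℝ => w + t * c) c 0 := by
      simpa using ((hasDerivAt_id (0:ℝ)).mul_const c).const_add w
    have h2 : HasDerivAt G (f w) (w + 0 * c) := by simpa using hG w
    exact h2.comp (0:ℝ) h1
  have hKd : HasDerivAt K (((1 - p) * b - p * a) * (f v - f u)) 0 := by
    have := (((hl v (-a)).sub (hl u (-a))).const_mul p).add
      (((hl v b).sub (hl u b)).const_mul (1 - p))
    refine (this.congr_deriv (by ring)).congr_of_eventuallyEq
      (Filter.Eventually.of_forall fun t => ?_)
    simp [K, sub_eq_add_neg]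
  have hneg : ((1 - p) * b - p * a) * (f v - f u) < 0 :=
    mul_neg_of_neg_of_pos (by linarith) (by linarith)
  have hev := (hasDerivAt_iff_tendsto_slope.1 hKd).eventually (gt_mem_nhds hneg)
  have hev' : ∀ᶠ t in nhdsWithin (0:ℝ) (Set.Ioi 0), slope K 0 t < 0 :=
    hev.filter_mono (nhdsWithin_mono _ fun t (ht : 0 < t) => ht.ne')
  obtain ⟨t, ht, ht'⟩ := (hev'.and (Ioo_mem_nhdsGT hε)).exists
  rw [slope_def_field] at ht
  have := hK t ht'
  exact absurd ht (not_lt.2 (div_nonneg (by linarith) (by linarith [ht'.1])))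

theorem MixesWithCertaintyEquivalent.le_of_monotoneOn {p a b : ℝ} {f : ℝ → ℝ}
    (hp : p ∈ Set.Ioo (0:ℝ) 1) (hf : Continuous f) (hab : a < b)
    (h : MixesWithCertaintyEquivalent p (Set.Icc a b) f) (hmono : MonotoneOn f (Set.Icc a b)) :
    p * f a + (1 - p) * f b ≤ f (p * a + (1 - p) * b) := by
  obtain ⟨hp0, hp1⟩ := hp
  by_contra! hlt
  set m := p * a + (1 - p) * b with hm
  have ham : a < m := by nlinarith
  have hmb : m < b := by nlinarith
  have hfab : f a ≤ f b := hmono ⟨le_rfl, hab.le⟩ ⟨hab.le, le_rfl⟩ hab.le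
  obtain ⟨v, hv, hfv⟩ : p * f a + (1 - p) * f b ∈ f '' Set.Icc m b :=
    intermediate_value_Icc hmb.le hf.continuousOn ⟨hlt.le, by nlinarith⟩
  have hmv : m < v := lt_of_le_of_ne hv.1 fun e => by rw [← e] at hfv; linarith
  have hvb : v < b := by
    refine lt_of_le_of_ne hv.2 fun e => ?_
    rw [e] at hfv
    have := hmono ⟨le_rfl, hab.le⟩ ⟨ham.le, hmb.le⟩ ham.le
    nlinarith
  have hev : ∀ᶠ u in nhdsWithin m (Set.Ioi m), f u < f v :=
    (hf.continuousAt.eventually (gt_mem_nhds (hfv ▸ hlt))).filter_mono nhdsWithin_le_nhds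
  obtain ⟨u, hfu, hmu, huv⟩ := (hev.and (Ioo_mem_nhdsGT hmv)).exists
  refine absurd (le_of_forall_le_displaced_average (p := p) (a := u - a) (b := b - u)
    (ε := (b - v) / (b - u)) hf (div_pos (by linarith) (by linarith)) huv.le
    (by nlinarith) ?_) (not_le.2 hfu)
  rintro z ⟨huz, hzv⟩ t ⟨ht0, htε⟩
  have hub : 0 < b - u := by linarith
  rw [lt_div_iff₀ hub] at htε
  have ht1 : t < 1 := by nlinarith
  have hzI : z ∈ Set.Icc a b := ⟨by linarith, by linarith [hv.2]⟩
  have hvI : v ∈ Set.Icc a b := ⟨by linarith, hv.2⟩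
  have hfz : f a ≤ f z := hmono ⟨le_rfl, hab.le⟩ hzI hzI.1
  have hfzv : f z ≤ f v := hmono hzI hvI hzv
  have h1p : 0 < 1 - p := by linarith
  obtain ⟨c, hc, hfc⟩ : (f z - p * f a) / (1 - p) ∈ f '' Set.Icc z b := by
    refine intermediate_value_Icc hzI.2 hf.continuousOn ⟨?_, ?_⟩
    · rw [le_div_iff₀ h1p]; nlinarith
    · rw [div_le_iff₀ h1p]; nlinarith
  have hcI : c ∈ Set.Icc a b := ⟨hzI.1.trans hc.1, hc.2⟩
  have key := h z hzI a ⟨le_rfl, hab.le⟩ c hcI (by rw [hfc]; field_simp; ring) (1 - t)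
    ⟨by linarith, by linarith⟩
  have e1 : f ((1 - t) * z + (1 - (1 - t)) * a) ≤ f (z - t * (u - a)) := by
    have h1 : t * (u - a) ≤ t * (z - a) := by gcongr
    have h2 : 0 ≤ t * (u - a) := by nlinarith
    have h3 : t * (z - a) ≤ z - a := mul_le_of_le_one_left (by linarith) ht1.le
    refine hmono ⟨?_, ?_⟩ ⟨?_, ?_⟩ ?_ <;> linarith [hzI.2]
  have e2 : f ((1 - t) * z + (1 - (1 - t)) * c) ≤ f (z + t * (b - u)) := by
    have h1 : t * (c - z) ≤ t * (b - u) := by gcongr; exact hc.2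
    have h2 : 0 ≤ t * (c - z) := mul_nonneg ht0.le (sub_nonneg.2 hc.1)
    refine hmono ⟨?_, ?_⟩ ⟨?_, ?_⟩ ?_ <;> linarith [hzI.1]
  nlinarith

theorem MixesWithCertaintyEquivalent.le_of_antitoneOn {p a b : ℝ} {f : ℝ → ℝ}
    (hp : p ∈ Set.Ioo (0:ℝ) 1) (hf : Continuous f) (hab : a < b)
    (h : MixesWithCertaintyEquivalent p (Set.Icc a b) f) (hanti : AntitoneOn f (Set.Icc a b)) :
    p * f a + (1 - p) * f b ≤ f (p * a + (1 - p) * b) := by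
  have hneg : ∀ x ∈ Set.Icc (-b) (-a), -x ∈ Set.Icc a b := fun x hx =>
    ⟨by linarith [hx.2], by linarith [hx.1]⟩
  have h' : MixesWithCertaintyEquivalent (1 - p) (Set.Icc (-b) (-a)) fun x => f (-x) := by
    intro z hz x hx y hy hzxy α hα
    beta_reduce at hzxy ⊢
    have := h (-z) (hneg z hz) (-y) (hneg y hy) (-x) (hneg x hx) (by linarith) α hα
    rw [show -(α * z + (1 - α) * x) = α * -z + (1 - α) * -x by ring,
      show -(α * z + (1 - α) * y) = α * -z + (1 - α) * -y by ring]
    linarith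
  have key := h'.le_of_monotoneOn ⟨by linarith [hp.2], by linarith [hp.1]⟩ (by fun_prop)
    (neg_lt_neg hab) fun x hx y hy hxy => hanti (hneg y hy) (hneg x hx) (neg_le_neg hxy)
  simp only [neg_neg] at key
  rw [show -((1 - p) * -b + (1 - (1 - p)) * -a) = p * a + (1 - p) * b by ring] at key
  linarith

theorem MixesWithCertaintyEquivalent.min_le {p a b s m t : ℝ} {f : ℝ → ℝ} (hf : Continuous f)
    (h : MixesWithCertaintyEquivalent p (Set.Icc a b) f) (has : a ≤ s) (hsm : s ≤ m)
    (hmt : m ≤ t) (htb : t ≤ b) : min (f s) (f t) ≤ f m := by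
  by_contra! hlt
  obtain ⟨x, hx, hfx⟩ : min (f s) (f t) ∈ f '' Set.Icc s m :=
    intermediate_value_Icc' hsm hf.continuousOn ⟨hlt.le, min_le_left _ _⟩
  obtain ⟨y, hy, hfy⟩ : min (f s) (f t) ∈ f '' Set.Icc m t :=
    intermediate_value_Icc hmt hf.continuousOn ⟨hlt.le, min_le_right _ _⟩
  have hxm : x < m := lt_of_le_of_ne hx.2 fun e => by rw [e] at hfx; linarith
  have hmy : m < y := lt_of_le_of_ne hy.1 fun e => by rw [← e] at hfy; linarith
  have hyx : 0 < y - x := by linarith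
  have hyI : y ∈ Set.Icc a b := ⟨by linarith, hy.2.trans htb⟩
  have key := h x ⟨has.trans hx.1, by linarith⟩ y hyI y hyI (by rw [hfx, hfy]; ring)
    ((y - m) / (y - x))
    ⟨div_pos (by linarith) hyx, (div_lt_one hyx).2 (by linarith)⟩
  have e : (y - m) / (y - x) * x + (1 - (y - m) / (y - x)) * y = m := by field_simp; ring
  rw [e] at key
  linarith

/-- A continuous function that satisfies the concavity inequality with a fixed weight on either
side of a maximizer lies above its chord. -/
theorem chord_le_of_isMaxOn {p a b c : ℝ} {f : ℝ → ℝ} (hp : p ∈ Set.Ioo (0:ℝ) 1)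
    (hf : Continuous f) (hab : a < b) (hc : IsMaxOn f (Set.Icc a b) c)
    (hleft : ∀ x y, a ≤ x → x < y → y ≤ min b c →
      p * f x + (1 - p) * f y ≤ f (p * x + (1 - p) * y))
    (hright : ∀ x y, max a c ≤ x → x < y → y ≤ b →
      p * f x + (1 - p) * f y ≤ f (p * x + (1 - p) * y))
    {α : ℝ} (hα : α ∈ Set.Icc (0:ℝ) 1) :
    α * f b + (1 - α) * f a ≤ f (α * b + (1 - α) * a) := by
  obtain ⟨hp0, hp1⟩ := hp
  have hba : 0 < b - a := by linarith
  obtain ⟨k, hk⟩ : ∃ k, k * (b - a) = f b - f a := ⟨(f b - f a) / (b - a), by field_simp⟩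
  let g : ℝ → ℝ := fun x => f x - f a - k * (x - a)
  have hg : Continuous g := by fun_prop
  have hga : g a = 0 := by simp [g]
  have hgb : g b = 0 := by simp only [g, hk]; ring
  suffices hpos : ∀ x ∈ Set.Icc a b, 0 ≤ g x by
    have := hpos (α * b + (1 - α) * a) ⟨by nlinarith [hα.1, hα.2], by nlinarith [hα.1, hα.2]⟩
    simp only [g] at this
    have e : k * (α * b + (1 - α) * a - a) = α * (f b - f a) := by rw [← hk]; ring
    rw [e] at this
    linarith
  by_contra! hex
  obtain ⟨w, hw, hgw⟩ := hex
  obtain ⟨s₀, hs₀, hmin₀⟩ := isCompact_Icc.exists_isMinOn ⟨w, hw⟩ hg.continuousOn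
  -- The leftmost minimizer of `g`.
  obtain ⟨s, ⟨hs, hgs⟩, hleast⟩ := (isCompact_Icc.inter_right
    (isClosed_singleton.preimage hg) : IsCompact (Set.Icc a b ∩ g ⁻¹' {g s₀})).exists_isLeast
    ⟨s₀, hs₀, rfl⟩
  have hmin : ∀ x ∈ Set.Icc a b, g s ≤ g x := fun x hx => by
    rw [show g s = g s₀ from hgs]; exact hmin₀ hx
  have hstrict : ∀ x ∈ Set.Icc a b, x < s → g s < g x := fun x hx hxs =>
    lt_of_le_of_ne (hmin x hx) fun e =>
      absurd (hleast ⟨hx, e.symm.trans hgs⟩) (not_le.2 hxs)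
  have hgs0 : g s < 0 := (hmin w hw).trans_lt hgw
  have has : a < s := lt_of_le_of_ne hs.1 fun e => by rw [← e] at hgs0; linarith
  have hsb : s < b := lt_of_le_of_ne hs.2 fun e => by rw [e] at hgs0; linarith
  have hcontra : ∀ d, 0 < d → a ≤ s - d → s + d ≤ b →
      ¬ p * f (s - (1 - p) * d) + (1 - p) * f (s + p * d) ≤
        f (p * (s - (1 - p) * d) + (1 - p) * (s + p * d)) := by
    intro d hd h1 h2 h3
    have i1 := hstrict (s - (1 - p) * d) ⟨by nlinarith, by nlinarith⟩ (by nlinarith)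
    have i2 := hmin (s + p * d) ⟨by nlinarith, by nlinarith⟩
    rw [show p * (s - (1 - p) * d) + (1 - p) * (s + p * d) = s by ring] at h3
    simp only [g] at i1 i2
    nlinarith
  rcases lt_trichotomy s c with hsc | hsc | hsc
  · obtain ⟨d, hd0, hd⟩ := exists_between
      (lt_min (sub_pos.2 has) (sub_pos.2 (lt_min hsb hsc)))
    have h1 := hd.trans_le (min_le_left _ _)
    have h2 := hd.trans_le (min_le_right _ _)
    have h3 := min_le_left b c
    exact hcontra d hd0 (by linarith) (by linarith)
      (hleft _ _ (by nlinarith) (by nlinarith) (by nlinarith))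
  · have h1 : f a ≤ f s := hsc ▸ hc ⟨le_rfl, hab.le⟩
    have h2 : f b ≤ f s := hsc ▸ hc ⟨hab.le, le_rfl⟩
    have h3 : g s * (b - a) = (b - s) * (f s - f a) + (s - a) * (f s - f b) := by
      simp only [g]; linear_combination (-(s - a)) * hk
    nlinarith
  · obtain ⟨d, hd0, hd⟩ := exists_between
      (lt_min (sub_pos.2 hsb) (sub_pos.2 (max_lt has hsc)))
    have h1 := hd.trans_le (min_le_left _ _)
    have h2 := hd.trans_le (min_le_right _ _)
    have h3 := le_max_left a c
    exact hcontra d hd0 (by linarith) (by linarith)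
      (hright _ _ (by nlinarith) (by nlinarith) (by nlinarith))

theorem MixesWithCertaintyEquivalent.chord_le {p a b : ℝ} {f : ℝ → ℝ}
    (hp : p ∈ Set.Ioo (0:ℝ) 1) (hf : Continuous f) (hab : a < b)
    (h : MixesWithCertaintyEquivalent p (Set.Icc a b) f) {α : ℝ} (hα : α ∈ Set.Icc (0:ℝ) 1) :
    α * f b + (1 - α) * f a ≤ f (α * b + (1 - α) * a) := by
  obtain ⟨c, hcI, hc⟩ := isCompact_Icc.exists_isMaxOn (Set.nonempty_Icc.2 hab.le) hf.continuousOn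
  refine chord_le_of_isMaxOn hp hf hab hc (fun x y hax hxy hy => ?_)
    (fun x y hx hxy hyb => ?_) hα
  · have hyc := hy.trans (min_le_right _ _)
    refine (h.mono (Set.Icc_subset_Icc hax (hyc.trans hcI.2))).le_of_monotoneOn hp hf hxy ?_
    intro s hs t ht hst
    have := h.min_le hf (hax.trans hs.1) hst (ht.2.trans hyc) hcI.2
    rwa [min_eq_left (hc ⟨hax.trans hs.1, (hs.2.trans hyc).trans hcI.2⟩)] at this
  · have hcx := (le_max_right _ _).trans hx
    refine (h.mono (Set.Icc_subset_Icc (hcI.1.trans hcx) hyb)).le_of_antitoneOn hp hf hxy ?_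
    intro s hs t ht hst
    have := h.min_le hf hcI.1 (hcx.trans hs.1) hst (ht.2.trans hyb)
    rwa [min_eq_right (hc ⟨(hcI.1.trans hcx).trans ht.1, ht.2.trans hyb⟩)] at this

/-- Antimonotonic convexity of the expected utility preference makes utility concave. -/
theorem concave_of_antimonotonic_convexity {Ω : Type*} [MeasurableSpace Ω]
    (P : Measure Ω) [IsProbabilityMeasure P]
    (hnd : ∃ A : Set Ω, MeasurableSet A ∧ 0 < P A ∧ P A < 1)
    {V : Type*} [AddCommGroup V] [Module ℝ V] {C : Set V} (hconv : Convex ℝ C) {U : V → ℝ}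
    (hUcont : ∀ x ∈ C, ∀ y ∈ C,
      ContinuousOn (fun α : ℝ => U (α • x + (1 - α) • y)) (Set.Icc 0 1))
    (h : ∀ X Y : Ω → V, IsSimpleAct C X → IsSimpleAct C Y →
        AntimonotonicUActs U X Y → ∀ α ∈ Set.Ioo (0:ℝ) 1,
        expectedUtility P U X = expectedUtility P U Y →
        expectedUtility P U (α • X + (1 - α) • Y) ≥ expectedUtility P U X)
    {x y : V} (hx : x ∈ C) (hy : y ∈ C) {α : ℝ} (hα : α ∈ Set.Ioo (0:ℝ) 1) :
    α * U x + (1 - α) * U y ≤ U (α • x + (1 - α) • y) := by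
  classical
  obtain ⟨A, hA, hA0, hA1⟩ := hnd
  have hp : P.real A ∈ Set.Ioo (0:ℝ) 1 :=
    ⟨ENNReal.toReal_pos hA0.ne' hA1.ne_top, by
      simpa [Measure.real] using (ENNReal.toReal_lt_toReal hA1.ne_top ENNReal.one_ne_top).2 hA1⟩
  let q : ℝ → V := fun t => t • x + (1 - t) • y
  have hqC : ∀ t ∈ Set.Icc (0:ℝ) 1, q t ∈ C := fun t ht =>
    hconv hx hy ht.1 (sub_nonneg.2 ht.2) (by ring)
  let f : ℝ → ℝ := Set.IccExtend (zero_le_one (α := ℝ)) ((Set.Icc (0:ℝ) 1).domRestrict (U ∘ q))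
  have hf : Continuous f := (hUcont x hx y hy).domRestrict.Icc_extend'
  have hfq : ∀ t ∈ Set.Icc (0:ℝ) 1, f t = U (q t) := fun t ht =>
    Set.IccExtend_of_mem _ _ ht
  have hmix : MixesWithCertaintyEquivalent (P.real A) (Set.Icc 0 1) f := by
    intro z hz a ha b hb hzab β hβ
    have hI : ∀ t ∈ Set.Icc (0:ℝ) 1, β * z + (1 - β) * t ∈ Set.Icc (0:ℝ) 1 := fun t ht =>
      convex_Icc (0:ℝ) 1 hz ht hβ.1.le (sub_nonneg.2 hβ.2.le) (by ring)
    have hq : ∀ t, β • q z + (1 - β) • q t = q (β * z + (1 - β) * t) := fun t => by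
      simp only [q]; module
    rw [hfq _ hz, hfq _ ha, hfq _ hb] at hzab
    rw [hfq _ hz, hfq _ (hI a ha), hfq _ (hI b hb)]
    let X : SimpleFunc Ω V :=
      SimpleFunc.piecewise A hA (SimpleFunc.const Ω (q z)) (SimpleFunc.const Ω (q z))
    let Y : SimpleFunc Ω V :=
      SimpleFunc.piecewise A hA (SimpleFunc.const Ω (q a)) (SimpleFunc.const Ω (q b))
    have hXc : ∀ ω, X ω = q z := fun ω => by simp [X]
    have hX : IsSimpleAct C X := isSimpleAct_simpleFunc X fun ω => hXc ω ▸ hqC z hz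
    have hY : IsSimpleAct C Y := isSimpleAct_simpleFunc Y fun ω => by
      by_cases hω : ω ∈ A
      · simpa [Y, hω] using hqC a ha
      · simpa [Y, hω] using hqC b hb
    have hXY : AntimonotonicUActs U X Y := by
      rintro ⟨ω, ω', hlt, -⟩
      rw [hXc, hXc] at hlt
      exact lt_irrefl _ hlt
    have hXe : expectedUtility P U X = U (q z) := by
      rw [expectedUtility_piecewise P U hA]; ring
    have key := h X Y hX hY hXY β hβ (by rw [hXe, expectedUtility_piecewise P U hA, hzab])
    have hZ : β • (X : Ω → V) + (1 - β) • (Y : Ω → V) = SimpleFunc.piecewise A hA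
        (SimpleFunc.const Ω (q (β * z + (1 - β) * a)))
        (SimpleFunc.const Ω (q (β * z + (1 - β) * b))) := by
      ext ω
      rw [Pi.add_apply, Pi.smul_apply, Pi.smul_apply, hXc]
      by_cases hω : ω ∈ A <;> simp [Y, hω, hq]
    rw [hZ, expectedUtility_piecewise P U hA, hXe] at key
    exact key
  have hαI : α ∈ Set.Icc (0:ℝ) 1 := Set.Ioo_subset_Icc_self hα
  have key := hmix.chord_le hp hf zero_lt_one hαI
  simp only [mul_one, mul_zero, add_zero] at key
  rw [hfq _ hαI, hfq 1 (by simp), hfq 0 (by simp)] at key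
  simpa [q] using key

/-- Antimonotonic characterization of risk aversion in subjective expected
utility: for an expected-utility preference over simple acts with mixture
continuous utility on a convex outcome set, convexity of preference,
antimonotonic convexity of preference, and concavity of utility are all
equivalent. -/
theorem am_convexity_iff_concave_utility {Ω : Type*} [MeasurableSpace Ω]
    (P : Measure Ω) [IsProbabilityMeasure P]
    (hnd : ∃ A : Set Ω, MeasurableSet A ∧ 0 < P A ∧ P A < 1)
    {V : Type*} [AddCommGroup V] [Module ℝ V]
    (C : Set V) (hconv : Convex ℝ C) (hne : C.Nonempty)
    (U : V → ℝ)
    (hUcont : ∀ x ∈ C, ∀ y ∈ C,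
      ContinuousOn (fun α : ℝ => U (α • x + (1 - α) • y)) (Set.Icc 0 1)) :
    ((∀ X Y : Ω → V, IsSimpleAct C X → IsSimpleAct C Y → ∀ α ∈ Set.Ioo (0:ℝ) 1,
        expectedUtility P U X = expectedUtility P U Y →
        expectedUtility P U (α • X + (1 - α) • Y) ≥ expectedUtility P U X) ↔
      (∀ x ∈ C, ∀ y ∈ C, ∀ α ∈ Set.Ioo (0:ℝ) 1,
        U (α • x + (1 - α) • y) ≥ α * U x + (1 - α) * U y)) ∧
    ((∀ X Y : Ω → V, IsSimpleAct C X → IsSimpleAct C Y →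
        AntimonotonicUActs U X Y → ∀ α ∈ Set.Ioo (0:ℝ) 1,
        expectedUtility P U X = expectedUtility P U Y →
        expectedUtility P U (α • X + (1 - α) • Y) ≥ expectedUtility P U X) ↔
      (∀ x ∈ C, ∀ y ∈ C, ∀ α ∈ Set.Ioo (0:ℝ) 1,
        U (α • x + (1 - α) • y) ≥ α * U x + (1 - α) * U y)) := by
  have hback : (∀ x ∈ C, ∀ y ∈ C, ∀ α ∈ Set.Ioo (0:ℝ) 1,
      U (α • x + (1 - α) • y) ≥ α * U x + (1 - α) * U y) →
      ∀ X Y : Ω → V, IsSimpleAct C X → IsSimpleAct C Y → ∀ α ∈ Set.Ioo (0:ℝ) 1,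
        expectedUtility P U X = expectedUtility P U Y →
        expectedUtility P U (α • X + (1 - α) • Y) ≥ expectedUtility P U X := by
    intro hU X Y hX hY α hα he
    have := expectedUtility_mix_ge P hU hX hY hα
    rw [← he] at this
    linarith
  refine ⟨⟨fun h x hx y hy α hα => ?_, hback⟩, ⟨fun h x hx y hy α hα => ?_, fun hU X Y hX hY _ =>
    hback hU X Y hX hY⟩⟩
  · exact concave_of_antimonotonic_convexity P hnd hconv hUcont
      (fun X Y hX hY _ => h X Y hX hY) hx hy hα
  · exact concave_of_antimonotonic_convexity P hnd hconv hUcont h hx hy hα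
end

section
/- Let a < b be reals and f : ℝ → ℝ be continuous on [a,b]. Suppose f is not concave on [a,b], i.e., there exist x, y ∈ [a,b] and λ ∈ (0,1) with f(λx + (1−λ)y) < λf(x) + (1−λ)f(y). Then there exist m, M ∈ [a,b] with m ≠ M such that for every λ ∈ (0,1): f(λM + (1−λ)m) < λf(M) + (1−λ)f(m); that is, f lies strictly below its chord everywhere strictly between m and M. -/
/-- A point where a continuous function is negative, between two points where it is nonnegative,
lies in an open interval of negativity whose endpoints have nonnegative values. -/
lemma ContinuousOn.exists_Ioo_neg_of_nonneg_endpoints {g : ℝ → ℝ} {c d e : ℝ}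
    (hg : ContinuousOn g (Set.Icc c d)) (hc : 0 ≤ g c) (hd : 0 ≤ g d)
    (he : e ∈ Set.Icc c d) (hneg : g e < 0) :
    ∃ p ∈ Set.Icc c d, ∃ q ∈ Set.Icc c d, p < q ∧ 0 ≤ g p ∧ 0 ≤ g q ∧
      ∀ t ∈ Set.Ioo p q, g t < 0 := by
  have hleft : IsCompact (Set.Icc c e ∩ g ⁻¹' Set.Ici 0) :=
    isCompact_Icc.of_isClosed_subset
      ((hg.mono (Set.Icc_subset_Icc_right he.2)).preimage_isClosed_of_isClosed
      isClosed_Icc isClosed_Ici) Set.inter_subset_left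
  have hright : IsCompact (Set.Icc e d ∩ g ⁻¹' Set.Ici 0) :=
    isCompact_Icc.of_isClosed_subset
      ((hg.mono (Set.Icc_subset_Icc_left he.1)).preimage_isClosed_of_isClosed
      isClosed_Icc isClosed_Ici) Set.inter_subset_left
  obtain ⟨p, ⟨⟨hcp, hpe⟩, hp⟩, hpmax⟩ := hleft.exists_isGreatest ⟨c, ⟨le_rfl, he.1⟩, hc⟩
  obtain ⟨q, ⟨⟨heq, hqd⟩, hq⟩, hqmin⟩ := hright.exists_isLeast ⟨d, ⟨he.2, le_rfl⟩, hd⟩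
  rw [Set.mem_preimage, Set.mem_Ici] at hp hq
  have hpe' : p < e := lt_of_le_of_ne hpe (by rintro rfl; exact hneg.not_ge hp)
  refine ⟨p, ⟨hcp, hpe.trans he.2⟩, q, ⟨he.1.trans heq, hqd⟩, hpe'.trans_le heq, hp, hq, ?_⟩
  intro t ht
  by_contra! hgt
  rcases le_total t e with hte | het
  · exact (hpmax ⟨⟨hcp.trans ht.1.le, hte⟩, hgt⟩).not_gt ht.1
  · exact (hqmin ⟨⟨het, ht.2.le.trans hqd⟩, hgt⟩).not_gt ht.2

/-- If a continuous function on `[a,b]` is not concave, then there is a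
nondegenerate subinterval `[m, M]` on which it lies strictly below its chord
everywhere strictly in between. -/
theorem exists_strictly_below_chord (a b : ℝ) (hab : a < b) (f : ℝ → ℝ)
    (hf : ContinuousOn f (Set.Icc a b))
    (hnc : ∃ x ∈ Set.Icc a b, ∃ y ∈ Set.Icc a b, ∃ l ∈ Set.Ioo (0:ℝ) 1,
      f (l * x + (1 - l) * y) < l * f x + (1 - l) * f y) :
    ∃ m ∈ Set.Icc a b, ∃ M ∈ Set.Icc a b, m ≠ M ∧
      ∀ l ∈ Set.Ioo (0:ℝ) 1,
        f (l * M + (1 - l) * m) < l * f M + (1 - l) * f m := by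
  obtain ⟨x, hx, y, hy, l, hl, hlt⟩ := hnc
  have hxy : x ≠ y := by
    rintro rfl
    rw [← add_mul, ← add_mul, add_sub_cancel, one_mul, one_mul] at hlt
    exact hlt.false
  have hmem : ∀ t ∈ Set.Icc (0:ℝ) 1, t * x + (1 - t) * y ∈ Set.Icc a b := fun t ht =>
    convex_Icc a b hx hy ht.1 (sub_nonneg.2 ht.2) (add_sub_cancel t 1)
  have hg : ContinuousOn (fun t => f (t * x + (1 - t) * y) - (t * f x + (1 - t) * f y))
      (Set.Icc 0 1) :=
    (hf.comp (by fun_prop) hmem).sub (by fun_prop)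
  obtain ⟨p, hp, q, hq, hpq, hgp, hgq, hneg⟩ :=
    hg.exists_Ioo_neg_of_nonneg_endpoints (by simp) (by simp) (Set.Ioo_subset_Icc_self hl)
      (sub_neg.2 hlt)
  refine ⟨_, hmem p hp, _, hmem q hq, fun h => ?_, fun u hu => ?_⟩
  · have : (q - p) * (x - y) = 0 := by linear_combination -h
    exact mul_ne_zero (sub_ne_zero.2 hpq.ne') (sub_ne_zero.2 hxy) this
  · have hlt' := hneg (u * q + (1 - u) * p)
      ⟨by nlinarith [mul_pos hu.1 (sub_pos.2 hpq)],
        by nlinarith [mul_pos (sub_pos.2 hu.2) (sub_pos.2 hpq)]⟩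
    have hpoint : u * (q * x + (1 - q) * y) + (1 - u) * (p * x + (1 - p) * y) =
        (u * q + (1 - u) * p) * x + (1 - (u * q + (1 - u) * p)) * y := by ring
    rw [hpoint]
    linarith [mul_nonneg hu.1.le hgq, mul_nonneg (sub_pos.2 hu.2).le hgp]
end

section
/- Let P be Lebesgue measure restricted to the Borel subsets of [0,1], let g : [0,1] → [0,1] be monotone nondecreasing with g(0) = 0 and g(1) = 1, and define the weighting function W(E) = g(P(E)) for Borel E ⊆ [0,1]. Then W is pseudo-convex — meaning g(P(A)) ≤ g(P(A ∪ B)) − g(P(B)) ≤ 1 − g(P(Aᶜ)) for all disjoint Borel sets A, B ⊆ [0,1] — if and only if g is superadditive (g(x + y) ≥ g(x) + g(y) for all x, y ∈ [0,1] with x + y ≤ 1) and satisfies g(x) + g(y) ≤ 1 + g(x + y − 1) for all x, y ∈ [0,1] with x + y ≥ 1. -/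
open MeasureTheory

/-- Lebesgue measure restricted to `[0,1]`. -/
noncomputable def lebOn01 : Measure ℝ := volume.restrict (Set.Icc (0:ℝ) 1)

instance isProbabilityMeasure_lebOn01 : IsProbabilityMeasure lebOn01 :=
  ⟨by simp [lebOn01]⟩

theorem toReal_lebOn01_mem_Icc (s : Set ℝ) : (lebOn01 s).toReal ∈ Set.Icc (0:ℝ) 1 :=
  ⟨measureReal_nonneg, measureReal_le_one⟩

theorem toReal_lebOn01_compl {s : Set ℝ} (hs : MeasurableSet s) :
    (lebOn01 sᶜ).toReal = 1 - (lebOn01 s).toReal :=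
  probReal_compl_eq_one_sub hs

theorem toReal_lebOn01_union {s t : Set ℝ} (hst : Disjoint s t) (ht : MeasurableSet t) :
    (lebOn01 (s ∪ t)).toReal = (lebOn01 s).toReal + (lebOn01 t).toReal :=
  measureReal_union hst ht

theorem Ico_subset_Icc_zero_one {a b : ℝ} (ha : 0 ≤ a) (hb : b ≤ 1) :
    Set.Ico a b ⊆ Set.Icc 0 1 :=
  Set.Ico_subset_Icc_self.trans (Set.Icc_subset_Icc ha hb)

theorem toReal_lebOn01_Ico {a b : ℝ} (ha : 0 ≤ a) (hab : a ≤ b) (hb : b ≤ 1) :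
    (lebOn01 (Set.Ico a b)).toReal = b - a := by
  rw [lebOn01, Measure.restrict_eq_self _ (Ico_subset_Icc_zero_one ha hb), Real.volume_Ico,
    ENNReal.toReal_ofReal (sub_nonneg.2 hab)]

/-- Any two nonnegative reals with sum at most `1` are the Lebesgue measures of two disjoint
Borel subsets of `[0,1]`. -/
theorem exists_disjoint_toReal_lebOn01_eq {a b : ℝ} (ha : 0 ≤ a) (hb : 0 ≤ b) (hab : a + b ≤ 1) :
    ∃ A B : Set ℝ, A ⊆ Set.Icc 0 1 ∧ B ⊆ Set.Icc 0 1 ∧ MeasurableSet A ∧ MeasurableSet B ∧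
      Disjoint A B ∧ (lebOn01 A).toReal = a ∧ (lebOn01 B).toReal = b := by
  refine ⟨Set.Ico 0 a, Set.Ico a (a + b), Ico_subset_Icc_zero_one le_rfl (by linarith),
    Ico_subset_Icc_zero_one ha hab, measurableSet_Ico, measurableSet_Ico,
    Set.Ico_disjoint_Ico_same, ?_, ?_⟩
  · rw [toReal_lebOn01_Ico le_rfl ha (by linarith), sub_zero]
  · rw [toReal_lebOn01_Ico ha (by linarith) hab, add_sub_cancel_left]

/-- For a distortion `g` of Lebesgue measure on `[0,1]`, pseudo-convexity of
the weighting function `W = g ∘ P` is equivalent to superadditivity of `g`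
together with `g x + g y ≤ 1 + g (x + y - 1)` for `x + y ≥ 1`. -/
theorem pseudoconvex_iff_superadditive (g : ℝ → ℝ)
    (hmono : MonotoneOn g (Set.Icc (0:ℝ) 1))
    (hrange : ∀ x ∈ Set.Icc (0:ℝ) 1, g x ∈ Set.Icc (0:ℝ) 1)
    (hg0 : g 0 = 0) (hg1 : g 1 = 1) :
    (∀ A B : Set ℝ, A ⊆ Set.Icc 0 1 → B ⊆ Set.Icc 0 1 →
      MeasurableSet A → MeasurableSet B → Disjoint A B →
      (g ((lebOn01 A).toReal) ≤
        g ((lebOn01 (A ∪ B)).toReal) - g ((lebOn01 B).toReal) ∧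
       g ((lebOn01 (A ∪ B)).toReal) - g ((lebOn01 B).toReal) ≤
        1 - g ((lebOn01 Aᶜ).toReal))) ↔
    ((∀ x ∈ Set.Icc (0:ℝ) 1, ∀ y ∈ Set.Icc (0:ℝ) 1, x + y ≤ 1 →
        g x + g y ≤ g (x + y)) ∧
     (∀ x ∈ Set.Icc (0:ℝ) 1, ∀ y ∈ Set.Icc (0:ℝ) 1, 1 ≤ x + y →
        g x + g y ≤ 1 + g (x + y - 1))) := by
  constructor
  · intro h
    have key : ∀ a b : ℝ, 0 ≤ a → 0 ≤ b → a + b ≤ 1 →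
        g a ≤ g (a + b) - g b ∧ g (a + b) - g b ≤ 1 - g (1 - a) := by
      intro a b ha hb hab
      obtain ⟨A, B, hA, hB, hAm, hBm, hAB, rfl, rfl⟩ := exists_disjoint_toReal_lebOn01_eq ha hb hab
      simpa only [toReal_lebOn01_compl hAm, toReal_lebOn01_union hAB hBm]
        using h A B hA hB hAm hBm hAB
    refine ⟨fun x hx y hy hxy => ?_, fun x hx y hy hxy => ?_⟩
    · linarith [(key x y hx.1 hy.1 hxy).1]
    · have hkey := (key (1 - y) (x + y - 1) (by linarith [hy.2]) (by linarith)
        (by linarith [hx.2])).2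
      rw [show 1 - y + (x + y - 1) = x by ring, sub_sub_cancel] at hkey
      linarith
  · rintro ⟨hsuper, hdual⟩ A B - - hAm hBm hAB
    have ha := toReal_lebOn01_mem_Icc A
    have hb := toReal_lebOn01_mem_Icc B
    have hab := toReal_lebOn01_mem_Icc (A ∪ B)
    rw [toReal_lebOn01_compl hAm]
    rw [toReal_lebOn01_union hAB hBm] at hab ⊢
    generalize (lebOn01 A).toReal = a at *
    generalize (lebOn01 B).toReal = b at *
    have hsup := hsuper a ha b hb hab.2
    have hdu := hdual (a + b) hab (1 - a) ⟨by linarith [ha.2], by linarith [ha.1]⟩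
      (by linarith [hb.1])
    rw [show a + b + (1 - a) - 1 = b by ring] at hdu
    exact ⟨by linarith, by linarith⟩
end

section
/- Define g : [0,1] → [0,1] as the piecewise linear function with g(0) = 0, g(0.7) = 0.1, g(0.8) = 0.25, g(0.9) = 0.3, g(1) = 1, and linear interpolation in between. Then: (a) g is superadditive: g(x + y) ≥ g(x) + g(y) for all x, y ∈ [0,1] with x + y ≤ 1; (b) g(x) + g(y) ≤ 1 + g(x + y − 1) for all x, y ∈ [0,1] with x + y ≥ 1; and (c) g is not convex on [0,1], i.e., there exist x, y ∈ [0,1] and λ ∈ (0,1) with g(λx + (1−λ)y) > λg(x) + (1−λ)g(y). -/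
/-- The piecewise linear weighting function of the paper's Example:
`g 0 = 0`, `g 0.7 = 0.1`, `g 0.8 = 0.25`, `g 0.9 = 0.3`, `g 1 = 1`,
with linear interpolation in between. -/
noncomputable def gExample (x : ℝ) : ℝ :=
  if x ≤ 0.7 then x / 7
  else if x ≤ 0.8 then 0.1 + 1.5 * (x - 0.7)
  else if x ≤ 0.9 then 0.25 + 0.5 * (x - 0.8)
  else 0.3 + 7 * (x - 0.9)

/-- The four affine pieces of `gExample`, each with the interval on which it is valid. -/
theorem gExample_cases (x : ℝ) :
    (x ≤ 7 / 10 ∧ gExample x = x / 7) ∨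
    (7 / 10 < x ∧ x ≤ 4 / 5 ∧ gExample x = 3 / 2 * x - 19 / 20) ∨
    (4 / 5 < x ∧ x ≤ 9 / 10 ∧ gExample x = x / 2 - 3 / 20) ∨
    (9 / 10 < x ∧ gExample x = 7 * x - 6) := by
  unfold gExample
  rcases le_or_gt x 0.7 with h₁ | h₁
  · left
    rw [if_pos h₁]
    constructor <;> linarith
  rw [if_neg h₁.not_ge]
  rcases le_or_gt x 0.8 with h₂ | h₂
  · right; left
    rw [if_pos h₂]
    refine ⟨?_, ?_, ?_⟩ <;> linarith
  rw [if_neg h₂.not_ge]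
  rcases le_or_gt x 0.9 with h₃ | h₃
  · right; right; left
    rw [if_pos h₃]
    refine ⟨?_, ?_, ?_⟩ <;> linarith
  · right; right; right
    rw [if_neg h₃.not_ge]
    constructor <;> linarith

theorem gExample_superadditive {x y : ℝ} (hx : 0 ≤ x) (hy : 0 ≤ y) (hxy : x + y ≤ 1) :
    gExample x + gExample y ≤ gExample (x + y) := by
  rcases gExample_cases x with h₁ | h₁ | h₁ | h₁ <;>
  rcases gExample_cases y with h₂ | h₂ | h₂ | h₂ <;>
  rcases gExample_cases (x + y) with h₃ | h₃ | h₃ | h₃ <;>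
  casesm* _ ∧ _ <;> linarith

theorem gExample_add_le_one_add {x y : ℝ} (hx : x ≤ 1) (hy : y ≤ 1) :
    gExample x + gExample y ≤ 1 + gExample (x + y - 1) := by
  rcases gExample_cases x with h₁ | h₁ | h₁ | h₁ <;>
  rcases gExample_cases y with h₂ | h₂ | h₂ | h₂ <;>
  rcases gExample_cases (x + y - 1) with h₃ | h₃ | h₃ | h₃ <;>
  casesm* _ ∧ _ <;> linarith

/-- The example weighting function is superadditive and satisfies
`g x + g y ≤ 1 + g (x + y - 1)` for `x + y ≥ 1` (i.e., `W = g ∘ P` is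
pseudo-convex), yet `g` is not convex on `[0,1]`. -/
theorem gExample_pseudoconvex_not_convex :
    (∀ x ∈ Set.Icc (0:ℝ) 1, ∀ y ∈ Set.Icc (0:ℝ) 1, x + y ≤ 1 →
      gExample (x + y) ≥ gExample x + gExample y) ∧
    (∀ x ∈ Set.Icc (0:ℝ) 1, ∀ y ∈ Set.Icc (0:ℝ) 1, 1 ≤ x + y →
      gExample x + gExample y ≤ 1 + gExample (x + y - 1)) ∧
    (∃ x ∈ Set.Icc (0:ℝ) 1, ∃ y ∈ Set.Icc (0:ℝ) 1, ∃ l ∈ Set.Ioo (0:ℝ) 1,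
      gExample (l * x + (1 - l) * y) > l * gExample x + (1 - l) * gExample y) := by
  refine ⟨fun x hx y hy hxy => gExample_superadditive hx.1 hy.1 hxy,
    fun x hx y hy _ => gExample_add_le_one_add hx.2 hy.2,
    0.7, by norm_num, 0.9, by norm_num, 1 / 2, by norm_num, ?_⟩
  norm_num [gExample]
end

section
/- Let Ω be a finite nonempty set and ≽ a binary relation on the acts Ω → ℝ whose restriction to constant acts agrees with ≥ on ℝ, such that every act has a certainty equivalent, ≽ is a weak order (complete and transitive), and ≽ satisfies antimonotonic additivity: whenever acts X and Z are antimonotonic and X ∼ x for a real x, then X + Z ∼ x + Z. Then the certainty-equivalent functional CE (assigning to each act X the unique real x with X ∼ x) is antimonotonically additive: CE(X + Y) = CE(X) + CE(Y) for all antimonotonic acts X, Y. -/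
/-- Two functions `X, Y : Ω → ℝ` are comonotonic if
`(X ω - X ω') * (Y ω - Y ω') ≥ 0` for all `ω, ω'`. -/
def Comonotonic {Ω : Type*} (X Y : Ω → ℝ) : Prop :=
  ∀ ω ω' : Ω, (X ω - X ω') * (Y ω - Y ω') ≥ 0

/-- `X` and `Y` are antimonotonic if `X` and `-Y` are comonotonic. -/
def Antimonotonic {Ω : Type*} (X Y : Ω → ℝ) : Prop :=
  Comonotonic X (-Y)

theorem Antimonotonic.const_right {Ω : Type*} (X : Ω → ℝ) (c : ℝ) :
    Antimonotonic X (Function.const Ω c) := by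
  intro ω ω'
  simp

/-- Under the hypotheses of the antimonotonic bookmaking theorem, the
certainty-equivalent functional is antimonotonically additive: if `x` and `y`
are certainty equivalents of the antimonotonic acts `X` and `Y`, then `x + y`
is a certainty equivalent of `X + Y`. -/
theorem certainty_equivalent_am_additive {Ω : Type*} [Fintype Ω] [Nonempty Ω]
    (R : (Ω → ℝ) → (Ω → ℝ) → Prop)
    (hconst : ∀ a b : ℝ, R (Function.const Ω a) (Function.const Ω b) ↔ a ≥ b)
    (hCE : ∀ X : Ω → ℝ, ∃ x : ℝ,
      R X (Function.const Ω x) ∧ R (Function.const Ω x) X)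
    (hcomplete : ∀ X Y : Ω → ℝ, R X Y ∨ R Y X)
    (htrans : ∀ X Y Z : Ω → ℝ, R X Y → R Y Z → R X Z)
    (hadd : ∀ X Z : Ω → ℝ, Antimonotonic X Z → ∀ x : ℝ,
      (R X (Function.const Ω x) ∧ R (Function.const Ω x) X) →
      (R (X + Z) (Function.const Ω x + Z) ∧
       R (Function.const Ω x + Z) (X + Z))) :
    ∀ X Y : Ω → ℝ, Antimonotonic X Y → ∀ x y : ℝ,
      (R X (Function.const Ω x) ∧ R (Function.const Ω x) X) →
      (R Y (Function.const Ω y) ∧ R (Function.const Ω y) Y) →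
      (R (X + Y) (Function.const Ω (x + y)) ∧
       R (Function.const Ω (x + y)) (X + Y)) := by
  intro X Y hXY x y hx hy
  have hX := hadd X Y hXY x hx
  have hY := hadd Y (Function.const Ω x) (Antimonotonic.const_right Y x) y hy
  have hconst_add : Function.const Ω y + Function.const Ω x = Function.const Ω (x + y) := by
    funext ω
    simp [add_comm]
  rw [hconst_add, add_comm Y] at hY
  exact ⟨htrans _ _ _ hX.1 hY.1, htrans _ _ _ hY.2 hX.2⟩
end
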